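/- Let (V,g,J) be a pseudo-hermitian vector space and let A, B be hermitian endomorphisms of V. For u,v ∈ V let R_{A,B}(u,v) denote the unique endomorphism of V with g(x, R_{A,B}(u,v)y) = R_{A,B}(x,y,u,v) for all x,y. Then, writing X := u∧v + Ju∧Jv (where x∧y is the endomorphism w ↦ g(x,w)y − g(y,w)x), one has R_{A,B}(u,v) = −(A X B + B X A − (1/2)·tr(J B X)·J A − (1/2)·tr(J A X)·J B). -/

import Mathlib

open Finset Polynomial

noncomputable section

/-- Kulkarni–Nomizu product of two bilinear forms (as 4-tensor):
`(P⊘Q)(x,y,u,v) = P(x,u)Q(y,v) − P(x,v)Q(y,u) + Q(x,u)P(y,v) − Q(x,v)P(y,u)`. -/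
def KN4 {V : Type*} [AddCommGroup V] [Module ℝ V] (P Q : V → V → ℝ) (x y u v : V) : ℝ :=
  P x u * Q y v - P x v * Q y u + Q x u * P y v - Q x v * P y u

/-- Symmetric product `(P⊙Q)(x,y,u,v) = P(x,y)Q(u,v) + Q(x,y)P(u,v)`. -/
def SP4 {V : Type*} [AddCommGroup V] [Module ℝ V] (P Q : V → V → ℝ) (x y u v : V) : ℝ :=
  P x y * Q u v + Q x y * P u v

/-- `R_{A,B} = gA⊘gB + ωA⊘ωB + 2·ωA⊙ωB`, where `gA = g(A·,·)` and `ωA = ω(A·,·)`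
with `ω(x,y) = g(Jx,y)`. -/
def RAB {V : Type*} [AddCommGroup V] [Module ℝ V]
    (g : V →ₗ[ℝ] V →ₗ[ℝ] ℝ) (J A B : Module.End ℝ V) (x y u v : V) : ℝ :=
  KN4 (fun a b => g (A a) b) (fun a b => g (B a) b) x y u v
    + KN4 (fun a b => g (J (A a)) b) (fun a b => g (J (B a)) b) x y u v
    + 2 * SP4 (fun a b => g (J (A a)) b) (fun a b => g (J (B a)) b) x y u v

/-- The endomorphism `x∧y : w ↦ g(x,w)y − g(y,w)x`. -/
def wedge {V : Type*} [AddCommGroup V] [Module ℝ V]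
    (g : V →ₗ[ℝ] V →ₗ[ℝ] ℝ) (x y : V) : Module.End ℝ V :=
  (g x).smulRight y - (g y).smulRight x

/-- The trace of `C ∘ (x ∧ y)`. -/
theorem trace_mul_wedge {V : Type*} [AddCommGroup V] [Module ℝ V] [FiniteDimensional ℝ V]
    (g : V →ₗ[ℝ] V →ₗ[ℝ] ℝ) (C : Module.End ℝ V) (x y : V) :
    LinearMap.trace ℝ V (C * wedge g x y) = g x (C y) - g y (C x) := by
  have h : C * wedge g x y = (g x).smulRight (C y) - (g y).smulRight (C x) := by
    ext w
    simp [wedge]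
  rw [h, map_sub, LinearMap.trace_smulRight, LinearMap.trace_smulRight]

/-- A `g`-isometric complex structure is `g`-skew. -/
theorem complexStructure_skew {V : Type*} [AddCommGroup V] [Module ℝ V]
    {g : V →ₗ[ℝ] V →ₗ[ℝ] ℝ} {J : Module.End ℝ V} (hJ2 : J * J = -1)
    (hJg : ∀ x y : V, g (J x) (J y) = g x y) (x y : V) : g (J x) y = -g x (J y) := by
  have h : J (J x) = -x := by simpa using LinearMap.congr_fun hJ2 x
  rw [← hJg (J x) y, h, map_neg, LinearMap.neg_apply]

/-- For `B` hermitian, half the trace of `J B X`, where `X = u ∧ v + Ju ∧ Jv`,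
is `-2 ω(B u, v)`. -/
theorem half_trace_complexStructure_mul {V : Type*} [AddCommGroup V] [Module ℝ V]
    [FiniteDimensional ℝ V] {g : V →ₗ[ℝ] V →ₗ[ℝ] ℝ} (hgsymm : ∀ x y : V, g x y = g y x)
    {J : Module.End ℝ V} (hJ2 : J * J = -1) (hJg : ∀ x y : V, g (J x) (J y) = g x y)
    {B : Module.End ℝ V} (hBg : ∀ x y : V, g (B x) y = g x (B y)) (hBJ : B * J = J * B)
    (u v : V) :
    (1 : ℝ) / 2 * LinearMap.trace ℝ V (J * B * (wedge g u v + wedge g (J u) (J v)))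
      = -2 * g (J (B u)) v := by
  have hBJ' (x : V) : B (J x) = J (B x) := LinearMap.congr_fun hBJ x
  have hsk := complexStructure_skew hJ2 hJg
  have huv : g u (J (B v)) = -g (J (B u)) v := by
    rw [hsk, hBg, hBJ', neg_neg]
  rw [mul_add, map_add, trace_mul_wedge, trace_mul_wedge]
  simp only [Module.End.mul_apply, hJg, hBJ', huv, hgsymm v (J (B u))]
  ring

/-- With `X := u∧v + Ju∧Jv`, the endomorphism `R_{A,B}(u,v)` (determined by
`g(x, R_{A,B}(u,v)y) = R_{A,B}(x,y,u,v)`) equals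
`−(AXB + BXA − (1/2)tr(JBX)·JA − (1/2)tr(JAX)·JB)`. -/
theorem stmt10
    (V : Type*) [AddCommGroup V] [Module ℝ V] [FiniteDimensional ℝ V]
    (g : V →ₗ[ℝ] V →ₗ[ℝ] ℝ)
    (hgsymm : ∀ x y : V, g x y = g y x)
    (hgnd : ∀ x : V, (∀ y : V, g x y = 0) → x = 0)
    (J : Module.End ℝ V)
    (hJ2 : J * J = -1)
    (hJg : ∀ x y : V, g (J x) (J y) = g x y)
    (A : Module.End ℝ V)
    (hAg : ∀ x y : V, g (A x) y = g x (A y))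
    (hAJ : A * J = J * A)
    (B : Module.End ℝ V)
    (hBg : ∀ x y : V, g (B x) y = g x (B y))
    (hBJ : B * J = J * B) :
    ∀ u v : V, ∀ Ruv : Module.End ℝ V,
      (∀ x y : V, g x (Ruv y) = RAB g J A B x y u v) →
      Ruv = -(A * (wedge g u v + wedge g (J u) (J v)) * B
            + B * (wedge g u v + wedge g (J u) (J v)) * A
            - ((1 : ℝ) / 2 * LinearMap.trace ℝ V (J * B * (wedge g u v + wedge g (J u) (J v)))) • (J * A)
            - ((1 : ℝ) / 2 * LinearMap.trace ℝ V (J * A * (wedge g u v + wedge g (J u) (J v)))) • (J * B)) := by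
  intro u v Ruv hR
  have hsk := complexStructure_skew hJ2 hJg
  have hskew {C : Module.End ℝ V} (hCg : ∀ x y : V, g (C x) y = g x (C y))
      (hCJ : C * J = J * C) (x y : V) : g x (J (C y)) = -g (J (C x)) y := by
    rw [hsk, hCg, ← Module.End.mul_apply C J, hCJ, Module.End.mul_apply, neg_neg]
  rw [half_trace_complexStructure_mul hgsymm hJ2 hJg hBg hBJ,
    half_trace_complexStructure_mul hgsymm hJ2 hJg hAg hAJ]
  ext y
  rw [← sub_eq_zero]
  refine hgnd _ fun x => ?_
  rw [hgsymm, map_sub, hR, sub_eq_zero]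
  simp only [RAB, KN4, SP4, wedge, LinearMap.neg_apply, LinearMap.sub_apply, LinearMap.add_apply,
    LinearMap.smul_apply, Module.End.mul_apply, LinearMap.smulRight_apply, map_neg, map_sub,
    map_add, map_smul, smul_eq_mul, hskew hAg hAJ x y, hskew hBg hBJ x y, ← hAg x, ← hBg x,
    hgsymm u, hgsymm v, hgsymm (J u), hgsymm (J v)]
  simp only [hsk (A x) u, hsk (A x) v, hsk (B x) u, hsk (B x) v,
    hsk (A y) u, hsk (A y) v, hsk (B y) u, hsk (B y) v]
  ring
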